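/- Let G be a graph of density p with positive discrepancy disc⁺(G) = α > 0. Then G contains a full subgraph on at least (1-p)^{-1/2}·(2α)^{1/2} vertices, i.e., f(G) ≥ (1-p)^{-1/2}·(2α)^{1/2}. -/

import Mathlib

open scoped Classical

/-- Number of neighbours of `v` inside `S`. -/
noncomputable def degIn {V : Type*} (G : SimpleGraph V) (S : Finset V) (v : V) : ℕ :=
  (S.filter fun u => G.Adj v u).card

/-- `S` induces a full subgraph for density `p`: every vertex of `S` has
at least `p * (|S| - 1)` neighbours inside `S`. -/
def IsFull {V : Type*} (G : SimpleGraph V) (p : ℝ) (S : Finset V) : Prop :=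
  ∀ v ∈ S, p * ((S.card : ℝ) - 1) ≤ (degIn G S v : ℝ)

/-- Number of edges of `G` inside `S`. -/
noncomputable def edgesIn {V : Type*} [Fintype V] (G : SimpleGraph V) (S : Finset V) : ℕ :=
  (G.edgeFinset.filter fun e => ∀ v ∈ e, v ∈ S).card

/-- `δ_p(S) = e(S) - p * C(|S|, 2)`. -/
noncomputable def disc {V : Type*} [Fintype V] (G : SimpleGraph V) (p : ℝ) (S : Finset V) : ℝ :=
  (edgesIn G S : ℝ) - p * (S.card.choose 2 : ℕ)

/-- The positive `p`-discrepancy: the maximum of `δ_p` over all vertex subsets. -/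
noncomputable def discPlus {V : Type*} [Fintype V] (G : SimpleGraph V) (p : ℝ) : ℝ :=
  Finset.univ.sup' Finset.univ_nonempty (fun S : Finset V => disc G p S)

theorem edgesIn_le_choose_two {V : Type*} [Fintype V] (G : SimpleGraph V) (S : Finset V) :
    edgesIn G S ≤ S.card.choose 2 := by
  rw [← Sym2.card_image_offDiag]
  refine Finset.card_le_card fun e he => ?_
  induction e with
  | _ x y =>
    simp only [Finset.mem_filter, SimpleGraph.mem_edgeFinset, SimpleGraph.mem_edgeSet,
      Sym2.mem_iff, forall_eq_or_imp, forall_eq] at he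
    exact Finset.mem_image.2 ⟨(x, y), Finset.mem_offDiag.2 ⟨he.2.1, he.2.2, he.1.ne⟩, rfl⟩

theorem edgesIn_le_edgesIn_erase_add_degIn {V : Type*} [Fintype V] (G : SimpleGraph V)
    (S : Finset V) (v : V) : edgesIn G S ≤ edgesIn G (S.erase v) + degIn G S v := by
  calc edgesIn G S
      ≤ ((G.edgeFinset.filter fun e => ∀ u ∈ e, u ∈ S.erase v) ∪
          (S.filter fun u => G.Adj v u).image fun u => s(v, u)).card := by
        refine Finset.card_le_card fun e he => ?_
        induction e with
        | _ x y =>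
          simp only [Finset.mem_filter, SimpleGraph.mem_edgeFinset, SimpleGraph.mem_edgeSet,
            Sym2.mem_iff, forall_eq_or_imp, forall_eq] at he
          obtain ⟨hxy, hx, hy⟩ := he
          by_cases hxv : x = v
          · subst hxv
            exact Finset.mem_union_right _
              (Finset.mem_image.2 ⟨y, Finset.mem_filter.2 ⟨hy, hxy⟩, rfl⟩)
          by_cases hyv : y = v
          · subst hyv
            exact Finset.mem_union_right _
              (Finset.mem_image.2 ⟨x, Finset.mem_filter.2 ⟨hx, hxy.symm⟩, Sym2.eq_swap⟩)
          · exact Finset.mem_union_left _ (by simp [hxy, hx, hy, hxv, hyv])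
    _ ≤ edgesIn G (S.erase v) + degIn G S v :=
        (Finset.card_union_le _ _).trans (Nat.add_le_add_left Finset.card_image_le _)

theorem isFull_of_forall_disc_le {V : Type*} [Fintype V] (G : SimpleGraph V) (p : ℝ)
    (S : Finset V) (hS : ∀ T, disc G p T ≤ disc G p S) : IsFull G p S := by
  intro v hv
  have hle := hS (S.erase v)
  have hedges : (edgesIn G S : ℝ) ≤ edgesIn G (S.erase v) + degIn G S v := by
    exact_mod_cast edgesIn_le_edgesIn_erase_add_degIn G S v
  have hcard : (S.card : ℝ) = (S.erase v).card + 1 := by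
    exact_mod_cast (Finset.card_erase_add_one hv).symm
  simp only [disc, Nat.cast_choose_two, hcard] at hle
  rw [hcard]
  linarith

theorem disc_le {V : Type*} [Fintype V] (G : SimpleGraph V) (p : ℝ) (S : Finset V) :
    disc G p S ≤ (1 - p) * (S.card.choose 2 : ℕ) := by
  have h : (edgesIn G S : ℝ) ≤ (S.card.choose 2 : ℕ) := by
    exact_mod_cast edgesIn_le_choose_two G S
  rw [disc]
  linarith

/-- if `G` has density `p` and positive discrepancy `α > 0`, then
`G` has a full subgraph on at least `(1-p)^(-1/2) (2α)^(1/2)` vertices. -/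
theorem stmt2 {V : Type*} [Fintype V] (G : SimpleGraph V) (p α : ℝ)
    (hp : (G.edgeFinset.card : ℝ) = p * ((Fintype.card V).choose 2 : ℕ))
    (hα : discPlus G p = α) (hαpos : 0 < α) :
    ∃ S : Finset V, IsFull G p S ∧
      (1 - p) ^ (-(1/2 : ℝ)) * (2 * α) ^ ((1/2 : ℝ)) ≤ (S.card : ℝ) := by
  obtain ⟨S, -, hS⟩ := Finset.exists_mem_eq_sup' Finset.univ_nonempty
    (fun S : Finset V => disc G p S)
  have hSα : disc G p S = α := hS.symm.trans hα
  refine ⟨S, isFull_of_forall_disc_le G p S fun T => ?_, ?_⟩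
  · exact (Finset.le_sup' (fun S : Finset V => disc G p S) (Finset.mem_univ T)).trans_eq hS
  have hle : α ≤ (1 - p) * (S.card.choose 2 : ℕ) := hSα ▸ disc_le G p S
  have hq : 0 < 1 - p := pos_of_mul_pos_left (hαpos.trans_le hle) (Nat.cast_nonneg _)
  rw [Real.rpow_neg hq.le, ← Real.sqrt_eq_rpow, ← Real.sqrt_eq_rpow,
    inv_mul_le_iff₀ (Real.sqrt_pos.2 hq)]
  apply Real.sqrt_le_iff.2
  refine ⟨by positivity, ?_⟩
  rw [mul_pow, Real.sq_sqrt hq.le]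
  rw [Nat.cast_choose_two] at hle
  nlinarith [mul_nonneg hq.le (Nat.cast_nonneg (α := ℝ) S.card)]
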